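/- Let e be a deterministic empirical model on a measurement scenario (X, M, O) that is not non-signalling. Then NSF(e) = 0, i.e. SF(e) = 1. -/

import Mathlib

/-- Joint outcome assignments for the measurements in `U`. -/
abbrev Assign {X : Type} (O : X → Type) (U : Finset X) : Type :=
  (x : {x : X // x ∈ U}) → O x.1

/-- Marginalisation of a (sub)distribution on `O_U` to `O_V` for `V ⊆ U`. -/
noncomputable def marginal {X : Type} [DecidableEq X] {O : X → Type}
    [∀ x, Fintype (O x)] [∀ x, DecidableEq (O x)]
    {U V : Finset X} (h : V ⊆ U) (d : Assign O U → ℝ) : Assign O V → ℝ :=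
  fun t => ∑ s : Assign O U,
    if (fun x : {x : X // x ∈ V} => s ⟨x.1, h x.2⟩) = t then d s else 0

/-- A model on the scenario with contexts `M`: a real-valued table for each context. -/
abbrev Model {X : Type} (O : X → Type) (M : Finset (Finset X)) : Type :=
  (C : {C : Finset X // C ∈ M}) → Assign O C.1 → ℝ

/-- `M` is a covering family of contexts for `X`. -/
def Covers {X : Type} (M : Finset (Finset X)) : Prop :=
  ∀ x : X, ∃ C ∈ M, x ∈ C

/-- An empirical model: each context carries a probability distribution. -/
def IsEmpirical {X : Type} [DecidableEq X] {O : X → Type} [∀ x, Fintype (O x)]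
    {M : Finset (Finset X)} (e : Model O M) : Prop :=
  ∀ C, (∀ s, 0 ≤ e C s) ∧ (∑ s, e C s) = 1

/-- Non-signalling: marginals agree on intersections of contexts. -/
def NonSignalling {X : Type} [DecidableEq X] {O : X → Type}
    [∀ x, Fintype (O x)] [∀ x, DecidableEq (O x)]
    {M : Finset (Finset X)} (e : Model O M) : Prop :=
  ∀ C C' : {C : Finset X // C ∈ M},
    marginal (Finset.inter_subset_left : C.1 ∩ C'.1 ⊆ C.1) (e C) =
      marginal (Finset.inter_subset_right : C.1 ∩ C'.1 ⊆ C'.1) (e C')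

/-- Deterministic: each context carries a Dirac (point-mass) distribution. -/
def Deterministic {X : Type} [DecidableEq X] {O : X → Type} [∀ x, DecidableEq (O x)]
    {M : Finset (Finset X)} (e : Model O M) : Prop :=
  ∀ C, ∃ s₀ : Assign O C.1, ∀ s, e C s = if s = s₀ then 1 else 0

/-- Marginal of a function on global assignments to the context `C`. -/
noncomputable def globMarg {X : Type} [Fintype X] [DecidableEq X] (O : X → Type)
    [∀ x, Fintype (O x)] [∀ x, DecidableEq (O x)]
    (C : Finset X) (b : (∀ x, O x) → ℝ) : Assign O C → ℝ :=
  fun t => ∑ g : ∀ x, O x,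
    if (fun x : {x : X // x ∈ C} => g x.1) = t then b g else 0

/-- The noncontextual fraction. -/
noncomputable def NCF {X : Type} [Fintype X] [DecidableEq X] {O : X → Type}
    [∀ x, Fintype (O x)] [∀ x, DecidableEq (O x)]
    {M : Finset (Finset X)} (e : Model O M) : ℝ :=
  sSup { r | ∃ b : (∀ x, O x) → ℝ, (∀ g, 0 ≤ b g) ∧
    (∀ C : {C : Finset X // C ∈ M}, ∀ t, globMarg O C.1 b t ≤ e C t) ∧
    r = ∑ g, b g }

/-- The contextual fraction. -/
noncomputable def CF {X : Type} [Fintype X] [DecidableEq X] {O : X → Type}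
    [∀ x, Fintype (O x)] [∀ x, DecidableEq (O x)]
    {M : Finset (Finset X)} (e : Model O M) : ℝ :=
  1 - NCF e

/-- The non-signalling fraction. -/
noncomputable def NSF {X : Type} [Fintype X] [DecidableEq X] {O : X → Type}
    [∀ x, Fintype (O x)] [∀ x, DecidableEq (O x)]
    {M : Finset (Finset X)} (e : Model O M) : ℝ :=
  sSup { r | ∃ b : (∀ x, O x) → ℝ,
    (∀ C : {C : Finset X // C ∈ M}, ∀ t,
      0 ≤ globMarg O C.1 b t ∧ globMarg O C.1 b t ≤ e C t) ∧
    r = ∑ g, b g }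

/-- The signalling fraction. -/
noncomputable def SF {X : Type} [Fintype X] [DecidableEq X] {O : X → Type}
    [∀ x, Fintype (O x)] [∀ x, DecidableEq (O x)]
    {M : Finset (Finset X)} (e : Model O M) : ℝ :=
  1 - NSF e

/-- The maximum incompatibility of marginals. -/
noncomputable def MIM {X : Type} [DecidableEq X] {O : X → Type}
    [∀ x, Fintype (O x)] [∀ x, DecidableEq (O x)]
    {M : Finset (Finset X)} (e : Model O M) : ℝ :=
  sSup { r | ∃ C C' : {C : Finset X // C ∈ M}, C.1 ≠ C'.1 ∧
    ∃ t : Assign O (C.1 ∩ C'.1),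
      r = |marginal (Finset.inter_subset_left : C.1 ∩ C'.1 ⊆ C.1) (e C) t -
            marginal (Finset.inter_subset_right : C.1 ∩ C'.1 ⊆ C'.1) (e C') t| }

/-- The generalised total variation distance between two models. -/
noncomputable def tvDist {X : Type} [DecidableEq X] {O : X → Type}
    [∀ x, Fintype (O x)]
    {M : Finset (Finset X)} (e e' : Model O M) : ℝ :=
  sSup { r | ∃ C : {C : Finset X // C ∈ M}, r = (1/2) * ∑ s, |e C s - e' C s| }

section Marginals

variable {X : Type} [DecidableEq X] {O : X → Type} [∀ x, Fintype (O x)] [∀ x, DecidableEq (O x)]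

/-- Marginalising a global function to `U` and then to `V ⊆ U` is marginalising it to `V`. -/
theorem marginal_globMarg [Fintype X] {U V : Finset X} (h : V ⊆ U) (b : (∀ x, O x) → ℝ) :
    marginal h (globMarg O U b) = globMarg O V b := by
  funext t
  have key (s : Assign O U) :
      (if (fun x : {x : X // x ∈ V} => s ⟨x.1, h x.2⟩) = t then globMarg O U b s else 0) =
        ∑ g : ∀ x, O x, if (fun x : {x : X // x ∈ U} => g x.1) = s then
          (if (fun x : {x : X // x ∈ V} => g x.1) = t then b g else 0) else 0 := by
    unfold globMarg
    split_ifs with hs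
    · refine Finset.sum_congr rfl fun g _ => ?_
      by_cases hg : (fun x : {x : X // x ∈ U} => g x.1) = s
      · subst hg
        simp [hs]
      · simp [hg]
    · refine (Finset.sum_eq_zero fun g _ => ?_).symm
      by_cases hg : (fun x : {x : X // x ∈ U} => g x.1) = s
      · subst hg
        simp [hs]
      · simp [hg]
  simp only [marginal, key]
  rw [Finset.sum_comm]
  simp [globMarg]

/-- The marginal of a global function has the same total weight. -/
theorem sum_globMarg [Fintype X] (U : Finset X) (b : (∀ x, O x) → ℝ) :
    ∑ t, globMarg O U b t = ∑ g, b g := by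
  simp only [globMarg]
  rw [Finset.sum_comm]
  simp

/-- The marginal of a function supported on a single assignment `s₀`. -/
theorem marginal_of_support_singleton {U V : Finset X} (h : V ⊆ U) {d : Assign O U → ℝ}
    {s₀ : Assign O U} (hd : ∀ s, s ≠ s₀ → d s = 0) (t : Assign O V) :
    marginal h d t =
      if (fun x : {x : X // x ∈ V} => s₀ ⟨x.1, h x.2⟩) = t then d s₀ else 0 := by
  unfold marginal
  refine Finset.sum_eq_single s₀ (fun s _ hs => ?_) (fun hs => absurd (Finset.mem_univ s₀) hs)
  rw [hd s hs, ite_self]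

end Marginals

theorem deterministic_signalling_NSF_zero {X : Type} [Fintype X] [DecidableEq X] {O : X → Type}
    [∀ x, Fintype (O x)] [∀ x, DecidableEq (O x)] [∀ x, Nonempty (O x)]
    {M : Finset (Finset X)} (hM : Covers M)
    (e : Model O M) (he : IsEmpirical e) (hdet : Deterministic e)
    (hsig : ¬ NonSignalling e) :
    NSF e = 0 ∧ SF e = 1 := by
  have hNSF : NSF e = 0 := by
    simp only [NonSignalling, not_forall] at hsig
    obtain ⟨C, C', hne⟩ := hsig
    obtain ⟨s, hs⟩ := hdet C
    obtain ⟨s', hs'⟩ := hdet C'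
    have hr : (fun x : {x : X // x ∈ C.1 ∩ C'.1} =>
          s' ⟨x.1, Finset.inter_subset_right x.2⟩) ≠
        fun x : {x : X // x ∈ C.1 ∩ C'.1} => s ⟨x.1, Finset.inter_subset_left x.2⟩ := by
      intro hr
      apply hne
      funext t
      rw [marginal_of_support_singleton _ (s₀ := s) (fun u hu => by rw [hs, if_neg hu]),
        marginal_of_support_singleton _ (s₀ := s') (fun u hu => by rw [hs', if_neg hu]), hr,
        hs, hs', if_pos rfl, if_pos rfl]
    have hfeas : { r | ∃ b : (∀ x, O x) → ℝ,
        (∀ C : {C : Finset X // C ∈ M}, ∀ t,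
          0 ≤ globMarg O C.1 b t ∧ globMarg O C.1 b t ≤ e C t) ∧
        r = ∑ g, b g } = {0} := by
      refine Set.eq_singleton_iff_unique_mem.2 ⟨⟨0, fun D t => ?_, by simp⟩, ?_⟩
      · simpa [globMarg] using (he D).1 t
      · rintro r ⟨b, hb, rfl⟩
        have hC : ∀ u, u ≠ s → globMarg O C.1 b u = 0 := fun u hu =>
          le_antisymm ((hb C u).2.trans_eq (by rw [hs, if_neg hu])) (hb C u).1
        have hC' : ∀ u, u ≠ s' → globMarg O C'.1 b u = 0 := fun u hu =>
          le_antisymm ((hb C' u).2.trans_eq (by rw [hs', if_neg hu])) (hb C' u).1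
        have hm := congrFun ((marginal_globMarg Finset.inter_subset_left b).trans
          (marginal_globMarg Finset.inter_subset_right b).symm)
          (fun x : {x : X // x ∈ C.1 ∩ C'.1} => s ⟨x.1, Finset.inter_subset_left x.2⟩)
        rw [marginal_of_support_singleton _ hC, marginal_of_support_singleton _ hC',
          if_pos rfl, if_neg hr] at hm
        rw [← sum_globMarg C.1 b, Fintype.sum_eq_single s hC, hm]
    rw [NSF, hfeas, csSup_singleton]
  exact ⟨hNSF, by rw [SF, hNSF, sub_zero]⟩
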